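/- arXiv:1404.2708 — 2 statements merged into one kernel-verified Lean document; each statement's English description precedes it below -/
import Mathlib

section
/- For every integer n ≥ 1 and every T ∈ 𝒮, there exist finitely many tuples (T_{0k}, T_{1k}, …, T_{nk}) of elements of 𝒮 such that Σ_k T_{0k}·[N,T_{1k}]⋯[N,T_{nk}] = 0 while Σ_k [N,T_{0k}]·[N,T_{1k}]⋯[N,T_{nk}] = T. (In the language of the paper: π_N(dJ₀^n(𝒮)) = 𝒮 for all n ≥ 1.) -/
noncomputable section

/-- `V` is the ℂ-vector space of finitely supported sequences `ℕ → ℂ`. -/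
def V : Type := ℕ →₀ ℂ

instance : AddCommGroup V := inferInstanceAs (AddCommGroup (ℕ →₀ ℂ))
instance : Module ℂ V := inferInstanceAs (Module ℂ (ℕ →₀ ℂ))

/-- The number operator `N`, determined by `N e_k = k e_k`. -/
def Nop : Module.End ℂ V := Finsupp.lsum ℂ fun k => (k : ℂ) • Finsupp.lsingle k

/-- The matrix unit `e_{ij}`, determined by `e_{ij} e_k = δ_{jk} e_i`. -/
def matUnit (i j : ℕ) : Module.End ℂ V := (Finsupp.lapply j).smulRight (Finsupp.single i 1)

/-- `𝒮`, the linear span of the matrix units (the finitely supported matrices). -/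
def finS : Submodule ℂ (Module.End ℂ V) :=
  Submodule.span ℂ (Set.range fun p : ℕ × ℕ => matUnit p.1 p.2)

/-- The commutator `[x, y] = x*y − y*x`. -/
def brkt {R : Type*} [Ring R] (x y : R) : R := x * y - y * x

theorem matUnit_mem_finS (i j : ℕ) : matUnit i j ∈ finS :=
  Submodule.subset_span ⟨(i, j), rfl⟩

/-- The standard basis vector `e_k`. -/
def basisVec (k : ℕ) : V := Finsupp.single k (1 : ℂ)

theorem End_V_ext {A B : Module.End ℂ V} (h : ∀ k, A (basisVec k) = B (basisVec k)) : A = B :=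
  Finsupp.lhom_ext' (M := ℂ) (N := V) fun k => LinearMap.ext_ring (h k)

theorem Nop_basisVec (k : ℕ) : Nop (basisVec k) = (k : ℂ) • basisVec k :=
  Finsupp.lsum_single (M := ℂ) (N := V) ℂ _ k 1

theorem matUnit_basisVec (i j k : ℕ) :
    matUnit i j (basisVec k) = if k = j then basisVec i else 0 := by
  have h : matUnit i j (basisVec k) = (Finsupp.single k (1 : ℂ) j) • basisVec i := rfl
  rw [h, Finsupp.single_apply, ite_smul, one_smul, zero_smul]

theorem matUnit_mul_matUnit (i j l : ℕ) : matUnit i j * matUnit j l = matUnit i l :=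
  End_V_ext fun k => by
    rw [Module.End.mul_apply, matUnit_basisVec, matUnit_basisVec]
    split_ifs
    · rw [matUnit_basisVec, if_pos rfl]
    · rw [map_zero]

theorem Nop_mul_matUnit (i j : ℕ) : Nop * matUnit i j = (i : ℂ) • matUnit i j :=
  End_V_ext fun k => by
    rw [Module.End.mul_apply, LinearMap.smul_apply, matUnit_basisVec]
    split_ifs
    · rw [Nop_basisVec]
    · rw [map_zero, smul_zero]

theorem matUnit_mul_Nop (i j : ℕ) : matUnit i j * Nop = (j : ℂ) • matUnit i j :=
  End_V_ext fun k => by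
    rw [Module.End.mul_apply, LinearMap.smul_apply, Nop_basisVec, map_smul, matUnit_basisVec]
    split_ifs with h
    · rw [h]
    · rw [smul_zero, smul_zero]

theorem brkt_Nop_matUnit (i j : ℕ) :
    brkt Nop (matUnit i j) = ((i : ℂ) - j) • matUnit i j := by
  rw [brkt, Nop_mul_matUnit, matUnit_mul_Nop, sub_smul]

theorem brkt_smul_right (c : ℂ) (x y : Module.End ℂ V) : brkt x (c • y) = c • brkt x y := by
  simp [brkt, smul_sub]

/-- An off-diagonal matrix unit is the commutator of `N` with an element of `𝒮`. -/
theorem exists_brkt_Nop_eq_matUnit {a j : ℕ} (h : a ≠ j) :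
    ∃ S ∈ finS, brkt Nop S = matUnit a j := by
  refine ⟨((a : ℂ) - j)⁻¹ • matUnit a j, finS.smul_mem _ (matUnit_mem_finS a j), ?_⟩
  rw [brkt_smul_right, brkt_Nop_matUnit, inv_smul_smul₀ (sub_ne_zero.2 (by exact_mod_cast h))]

/-- An off-diagonal matrix unit is a product of any positive number of commutators of `N`. -/
theorem exists_prod_brkt_Nop_eq_matUnit (n : ℕ) {a j : ℕ} (h : a ≠ j) :
    ∃ S : Fin (n + 1) → Module.End ℂ V, (∀ i, S i ∈ finS) ∧
      (List.ofFn fun i => brkt Nop (S i)).prod = matUnit a j := by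
  induction n generalizing a with
  | zero =>
    obtain ⟨S, hS, hb⟩ := exists_brkt_Nop_eq_matUnit h
    exact ⟨fun _ => S, fun _ => hS, by simp [hb]⟩
  | succ n ih =>
    obtain ⟨S, hS, hb⟩ := exists_brkt_Nop_eq_matUnit (show a ≠ a + j + 1 by lia)
    obtain ⟨R, hR, hp⟩ := ih (show a + j + 1 ≠ j by lia)
    refine ⟨Fin.cons S R, Fin.cases hS hR, ?_⟩
    rw [List.ofFn_succ, List.prod_cons]
    simp only [Fin.cons_zero, Fin.cons_succ]
    rw [hb, hp, matUnit_mul_matUnit]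

/-- For every `n ≥ 1` and every `T ∈ 𝒮` there are finitely many tuples
`(T₀ₖ, …, T_{nk})` in `𝒮` with `Σₖ T₀ₖ·[N,T₁ₖ]⋯[N,T_{nk}] = 0` and
`Σₖ [N,T₀ₖ]·[N,T₁ₖ]⋯[N,T_{nk}] = T`; i.e. `π_N(dJ₀ⁿ(𝒮)) = 𝒮`. -/
theorem stmt_1 (n : ℕ) (hn : 1 ≤ n) (T : Module.End ℂ V) (hT : T ∈ finS) :
    ∃ (K : ℕ) (T0 : Fin K → Module.End ℂ V) (Tr : Fin K → Fin n → Module.End ℂ V),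
      (∀ k, T0 k ∈ finS) ∧ (∀ k i, Tr k i ∈ finS) ∧
      (∑ k, T0 k * (List.ofFn fun i => brkt Nop (Tr k i)).prod = 0) ∧
      (∑ k, brkt Nop (T0 k) * (List.ofFn fun i => brkt Nop (Tr k i)).prod = T) := by
  obtain ⟨n, rfl⟩ := Nat.exists_eq_add_of_le' hn
  unfold finS at hT
  induction hT using Submodule.span_induction with
  | mem x hx =>
    obtain ⟨⟨i, j⟩, rfl⟩ := hx
    obtain ⟨R, hR, hp⟩ := exists_prod_brkt_Nop_eq_matUnit n (show i + j + 1 ≠ j by lia)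
    obtain ⟨S, hS, hq⟩ := exists_prod_brkt_Nop_eq_matUnit n (show i + j + 2 ≠ j by lia)
    refine ⟨2, ![matUnit i (i + j + 1), (-1 : ℂ) • matUnit i (i + j + 2)], ![R, S],
      ?_, ?_, ?_, ?_⟩
    · rw [Fin.forall_fin_two]
      exact ⟨matUnit_mem_finS _ _, finS.smul_mem _ (matUnit_mem_finS _ _)⟩
    · rw [Fin.forall_fin_two]
      exact ⟨hR, hS⟩
    · rw [Fin.sum_univ_two]
      simp only [Matrix.cons_val_zero, Matrix.cons_val_one, hp, hq, smul_mul_assoc,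
        matUnit_mul_matUnit]
      module
    · rw [Fin.sum_univ_two]
      simp only [Matrix.cons_val_zero, Matrix.cons_val_one, hp, hq, brkt_smul_right,
        brkt_Nop_matUnit, smul_mul_assoc, matUnit_mul_matUnit]
      push_cast
      module
  | zero => exact ⟨0, Fin.elim0, Fin.elim0, by simp⟩
  | add x y _ _ hx hy =>
    obtain ⟨K, T0, Tr, h0, hr, hs, ht⟩ := hx
    obtain ⟨L, S0, Sr, k0, kr, ks, kt⟩ := hy
    refine ⟨K + L, Fin.append T0 S0, Fin.append Tr Sr, ?_, ?_, ?_, ?_⟩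
    · exact fun k => Fin.addCases (by simpa using h0) (by simpa using k0) k
    · exact fun k => Fin.addCases (by simpa using hr) (by simpa using kr) k
    · simp only [Fin.sum_univ_add, Fin.append_left, Fin.append_right, hs, ks, add_zero]
    · simp only [Fin.sum_univ_add, Fin.append_left, Fin.append_right, ht, kt]
  | smul c x _ hx =>
    obtain ⟨K, T0, Tr, h0, hr, hs, ht⟩ := hx
    refine ⟨K, fun k => c • T0 k, Tr, fun k => finS.smul_mem c (h0 k), hr, ?_, ?_⟩
    · simp only [smul_mul_assoc, ← Finset.smul_sum, hs, smul_zero]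
    · simp only [brkt_smul_right, smul_mul_assoc, ← Finset.smul_sum, ht]
end
end

section
/- For every integer n ≥ 2, the following two subsets of End(V) are equal, and both equal 𝒮: (a) the set of finite sums Σ_k T_{0k}·[N,T_{1k}]⋯[N,T_{nk}] with all T_{ik} ∈ 𝒮; (b) the set of finite sums Σ_k [N,S_{0k}]·[N,S_{1k}]⋯[N,S_{n−1,k}] with all S_{ik} ∈ 𝒮 satisfying the constraint Σ_k S_{0k}·[N,S_{1k}]⋯[N,S_{n−1,k}] = 0. (Consequently Connes' space of forms Ω_N^n(𝒮) = π(Ω^n)/π(dJ₀^{n−1}) vanishes for all n ≥ 2, while Ω_N^n(𝒮) = 𝒮 for n = 0, 1.) -/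
noncomputable section

/-- The standard basis vector `e_k` of `V`. -/
def stdVec (k : ℕ) : V := (Finsupp.single k 1 : ℕ →₀ ℂ)

theorem matUnit_stdVec (i j k : ℕ) :
    matUnit i j (stdVec k) = if j = k then stdVec i else 0 := by
  change (Finsupp.single k (1 : ℂ) j) • stdVec i = _
  by_cases h : j = k
  · simp [h]
  · simp [h]

theorem Nop_stdVec (k : ℕ) : Nop (stdVec k) = (k : ℂ) • stdVec k := by
  refine (Finsupp.lsum_single ℂ (N := ℕ →₀ ℂ)
    (fun k : ℕ => (k : ℂ) • (Finsupp.lsingle k : ℂ →ₗ[ℂ] ℕ →₀ ℂ)) k (1 : ℂ)).trans ?_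
  rfl

theorem end_ext {f g : Module.End ℂ V} (h : ∀ k, f (stdVec k) = g (stdVec k)) : f = g :=
  Finsupp.lhom_ext' (M := ℂ) (R := ℂ) (N := V) fun k => LinearMap.ext_ring (h k)

theorem matUnit_mul (i j k l : ℕ) :
    matUnit i j * matUnit k l = if j = k then matUnit i l else 0 := by
  refine end_ext fun m => ?_
  rw [Module.End.mul_apply, matUnit_stdVec]
  split_ifs <;> simp_all [matUnit_stdVec]

theorem brkt_smul {R A : Type*} [CommRing R] [Ring A] [Algebra R A] (c : R) (x y : A) :
    brkt x (c • y) = c • brkt x y := by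
  simp [brkt, smul_sub]

theorem brkt_add {R : Type*} [Ring R] (x y z : R) :
    brkt x (y + z) = brkt x y + brkt x z := by
  simp only [brkt]; noncomm_ring

theorem finS_mul_mem {x y : Module.End ℂ V} (hx : x ∈ finS) (hy : y ∈ finS) :
    x * y ∈ finS := by
  have h : finS * finS ≤ finS := by
    rw [finS, Submodule.span_mul_span, Submodule.span_le]
    rintro _ ⟨_, ⟨⟨i, j⟩, rfl⟩, _, ⟨⟨k, l⟩, rfl⟩, rfl⟩
    change matUnit i j * matUnit k l ∈ finS
    rw [matUnit_mul]
    split_ifs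
    · exact matUnit_mem_finS i l
    · exact zero_mem _
  exact h (Submodule.mul_mem_mul hx hy)

theorem brkt_Nop_mem_finS {x : Module.End ℂ V} (hx : x ∈ finS) : brkt Nop x ∈ finS := by
  induction hx using Submodule.span_induction with
  | mem x h =>
    obtain ⟨⟨i, j⟩, rfl⟩ := h
    change brkt Nop (matUnit i j) ∈ finS
    rw [brkt_Nop_matUnit]
    exact finS.smul_mem _ (matUnit_mem_finS i j)
  | zero => simp [brkt]
  | add x y _ _ hx hy => rw [brkt_add]; exact finS.add_mem hx hy
  | smul c x _ hx => rw [brkt_smul]; exact finS.smul_mem c hx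

theorem finS_mul_list_prod_mem {x : Module.End ℂ V} (hx : x ∈ finS)
    {l : List (Module.End ℂ V)} (hl : ∀ y ∈ l, y ∈ finS) : x * l.prod ∈ finS := by
  induction l generalizing x with
  | nil => simpa using hx
  | cons y l ih =>
    rw [List.prod_cons, ← mul_assoc]
    exact ih (finS_mul_mem hx (hl y (by simp))) fun z hz => hl z (by simp [hz])

theorem finS_mul_brkt_prod_mem {m : ℕ} {x : Module.End ℂ V} (hx : x ∈ finS)
    {T : Fin m → Module.End ℂ V} (hT : ∀ i, T i ∈ finS) :
    x * (List.ofFn fun i => brkt Nop (T i)).prod ∈ finS := by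
  refine finS_mul_list_prod_mem hx fun y hy => ?_
  obtain ⟨i, rfl⟩ := (List.mem_ofFn' _ _).1 hy
  exact brkt_Nop_mem_finS (hT i)

/-- An off-diagonal matrix unit is a product of any positive number of commutators `[N, T]`. -/
theorem exists_brkt_prod_eq_matUnit {m : ℕ} (hm : 1 ≤ m) {a j : ℕ} (haj : a ≠ j) :
    ∃ T : Fin m → Module.End ℂ V, (∀ i, T i ∈ finS) ∧
      (List.ofFn fun i => brkt Nop (T i)).prod = matUnit a j := by
  have key : ∀ {a b : ℕ}, a ≠ b →
      brkt Nop (((a : ℂ) - b)⁻¹ • matUnit a b) = matUnit a b := by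
    intro a b hab
    have : (a : ℂ) - b ≠ 0 := sub_ne_zero.2 (Nat.cast_injective.ne hab)
    rw [brkt_smul, brkt_Nop_matUnit, inv_smul_smul₀ this]
  have mem : ∀ a b : ℕ, ((a : ℂ) - b)⁻¹ • matUnit a b ∈ finS :=
    fun a b => finS.smul_mem _ (matUnit_mem_finS a b)
  induction m, hm using Nat.le_induction generalizing a with
  | base => exact ⟨fun _ => _, fun _ => mem a j, by simp [key haj]⟩
  | succ m _ ih =>
    have hc : a ≠ a + j + 1 := by omega
    obtain ⟨T, hT, hp⟩ := ih (a := a + j + 1) (by omega)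
    refine ⟨Fin.cons (((a : ℂ) - (a + j + 1 : ℕ))⁻¹ • matUnit a (a + j + 1)) T,
      Fin.cases (mem _ _) hT, ?_⟩
    simp only [List.ofFn_succ, Fin.cons_zero, Fin.cons_succ, List.prod_cons]
    rw [hp, key hc, matUnit_mul, if_pos rfl]

/-- The pairs `(S₀·[N,S₁]⋯[N,Sₘ], [N,S₀]·[N,S₁]⋯[N,Sₘ])` with all `Sᵢ ∈ 𝒮`. -/
def formPairs (m : ℕ) : Set (Module.End ℂ V × Module.End ℂ V) :=
  {p | ∃ (S0 : Module.End ℂ V) (S : Fin m → Module.End ℂ V), S0 ∈ finS ∧ (∀ i, S i ∈ finS) ∧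
    p = (S0 * (List.ofFn fun i => brkt Nop (S i)).prod,
      brkt Nop S0 * (List.ofFn fun i => brkt Nop (S i)).prod)}

theorem exists_sum_of_mem_span_formPairs {m : ℕ} {p : Module.End ℂ V × Module.End ℂ V}
    (hp : p ∈ Submodule.span ℂ (formPairs m)) :
    ∃ (K : ℕ) (S0 : Fin K → Module.End ℂ V) (S : Fin K → Fin m → Module.End ℂ V),
      (∀ k, S0 k ∈ finS) ∧ (∀ k i, S k i ∈ finS) ∧
      p.1 = ∑ k, S0 k * (List.ofFn fun i => brkt Nop (S k i)).prod ∧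
      p.2 = ∑ k, brkt Nop (S0 k) * (List.ofFn fun i => brkt Nop (S k i)).prod := by
  obtain ⟨K, c, g, rfl⟩ := Submodule.mem_span_set'.1 hp
  choose S0 S hS0 hS hg using fun k => (g k).2
  refine ⟨K, fun k => c k • S0 k, S, fun k => finS.smul_mem _ (hS0 k), hS, ?_, ?_⟩
  · simp [Prod.fst_sum, hg]
  · simp [Prod.snd_sum, hg, brkt_smul]

theorem matUnit_pair_mem_formPairs {m : ℕ} (hm : 1 ≤ m) (i : ℕ) {a j : ℕ} (haj : a ≠ j) :
    (matUnit i j, ((i : ℂ) - a) • matUnit i j) ∈ formPairs m := by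
  obtain ⟨T, hT, hp⟩ := exists_brkt_prod_eq_matUnit hm haj
  refine ⟨matUnit i a, T, matUnit_mem_finS i a, hT, ?_⟩
  rw [hp, brkt_Nop_matUnit, smul_mul_assoc, matUnit_mul, if_pos rfl]

theorem zero_prod_mem_span_formPairs {m : ℕ} (hm : 1 ≤ m) {x : Module.End ℂ V}
    (hx : x ∈ finS) : ((0 : Module.End ℂ V), x) ∈ Submodule.span ℂ (formPairs m) := by
  have h : finS ≤ (Submodule.span ℂ (formPairs m)).comap
      (LinearMap.inr ℂ (Module.End ℂ V) (Module.End ℂ V)) := by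
    refine Submodule.span_le.2 ?_
    rintro _ ⟨⟨i, j⟩, rfl⟩
    have h₁ := Submodule.subset_span (R := ℂ)
      (matUnit_pair_mem_formPairs hm i (a := j + 1) (j := j) (by omega))
    have h₂ := Submodule.subset_span (R := ℂ)
      (matUnit_pair_mem_formPairs hm i (a := j + 2) (j := j) (by omega))
    have h₃ := Submodule.sub_mem _ h₁ h₂
    rw [Prod.mk_sub_mk, sub_self, ← sub_smul] at h₃
    have hc : (i : ℂ) - (j + 1 : ℕ) - (i - (j + 2 : ℕ)) = 1 := by push_cast; ring
    rwa [hc, one_smul] at h₃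
  exact h hx

theorem exists_mem_span_formPairs_fst_eq {m : ℕ} (hm : 1 ≤ m) {x : Module.End ℂ V}
    (hx : x ∈ finS) : ∃ p ∈ Submodule.span ℂ (formPairs m), p.1 = x := by
  have h : finS ≤ (Submodule.span ℂ (formPairs m)).map
      (LinearMap.fst ℂ (Module.End ℂ V) (Module.End ℂ V)) := by
    refine Submodule.span_le.2 ?_
    rintro _ ⟨⟨i, j⟩, rfl⟩
    exact ⟨_, Submodule.subset_span
      (matUnit_pair_mem_formPairs hm i (a := j + 1) (j := j) (by omega)), rfl⟩
  exact h hx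

/-- For every `n ≥ 2`: (a) the set of finite sums `Σₖ T₀ₖ·[N,T₁ₖ]⋯[N,T_{nk}]`
(with all `T_{ik} ∈ 𝒮`) equals `𝒮`, and (b) the set of finite sums
`Σₖ [N,S₀ₖ]·[N,S₁ₖ]⋯[N,S_{n−1,k}]` subject to `Σₖ S₀ₖ·[N,S₁ₖ]⋯[N,S_{n−1,k}] = 0`
also equals `𝒮`.  (Hence `Ω_N^n(𝒮) = 0` for `n ≥ 2`.) -/
theorem stmt_2 (n : ℕ) (hn : 2 ≤ n) :
    ({x : Module.End ℂ V |
        ∃ (K : ℕ) (T0 : Fin K → Module.End ℂ V) (Tr : Fin K → Fin n → Module.End ℂ V),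
          (∀ k, T0 k ∈ finS) ∧ (∀ k i, Tr k i ∈ finS) ∧
          x = ∑ k, T0 k * (List.ofFn fun i => brkt Nop (Tr k i)).prod}
      = (finS : Set (Module.End ℂ V))) ∧
    ({x : Module.End ℂ V |
        ∃ (K : ℕ) (S0 : Fin K → Module.End ℂ V) (Sr : Fin K → Fin (n - 1) → Module.End ℂ V),
          (∀ k, S0 k ∈ finS) ∧ (∀ k i, Sr k i ∈ finS) ∧
          (∑ k, S0 k * (List.ofFn fun i => brkt Nop (Sr k i)).prod = 0) ∧
          x = ∑ k, brkt Nop (S0 k) * (List.ofFn fun i => brkt Nop (Sr k i)).prod}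
      = (finS : Set (Module.End ℂ V))) := by
  constructor
  · refine Set.Subset.antisymm ?_ fun x hx => ?_
    · rintro _ ⟨K, T0, T, hT0, hT, rfl⟩
      exact finS.sum_mem fun k _ => finS_mul_brkt_prod_mem (hT0 k) (hT k)
    · obtain ⟨p, hp, rfl⟩ := exists_mem_span_formPairs_fst_eq (m := n) (by omega) hx
      obtain ⟨K, T0, T, hT0, hT, h, -⟩ := exists_sum_of_mem_span_formPairs hp
      exact ⟨K, T0, T, hT0, hT, h⟩
  · refine Set.Subset.antisymm ?_ fun x hx => ?_
    · rintro _ ⟨K, S0, S, hS0, hS, -, rfl⟩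
      exact finS.sum_mem fun k _ => finS_mul_brkt_prod_mem (brkt_Nop_mem_finS (hS0 k)) (hS k)
    · obtain ⟨K, S0, S, hS0, hS, h₀, h⟩ := exists_sum_of_mem_span_formPairs
        (zero_prod_mem_span_formPairs (m := n - 1) (by omega) hx)
      exact ⟨K, S0, S, hS0, hS, h₀.symm, h⟩
end
end
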